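/- Let n be an odd positive integer and let (a_1,…,a_n) be an open meandric permutation of order n. Then the sequence of length 2n+35 consisting of (23, 22, 1, 4, 19, 26, 27, 18, 5, 8, 15, 32, 33, 14, 11), followed by the block of length n whose j-th entry (1 ≤ j ≤ n) equals 34+2a_j if j is odd and 34+2a_j−1 if j is even, followed by (29, 30), followed by the block of length n whose j-th entry (1 ≤ j ≤ n) equals 34+2a_{n+1−j}−1 if j is odd and 34+2a_{n+1−j} if j is even, followed by (12, 13, 34, 31, 16, 7, 6, 17, 28, 25, 20, 3, 2, 21, 24), followed by (2n+35, 10, 9), is an irreducible open meandric permutation of order 2n+35. -/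

import Mathlib

open Filter

/-- `x` lies strictly between `p` and `q`. -/
def StrictlyBetween (p q x : ℕ) : Prop := min p q < x ∧ x < max p q

/-- Two arcs `{p, q}` and `{r, s}` cross if exactly one of `r`, `s` lies strictly
between `p` and `q`. -/
def ArcsCross (p q r s : ℕ) : Prop :=
  Xor' (StrictlyBetween p q r) (StrictlyBetween p q s)

/-- `a` (with one-based indexing, only the values `a 1, …, a n` being relevant)
is an open meandric permutation of order `n`: it is a permutation of `{1, …, n}`
with `a i ≡ i (mod 2)`, whose upper arcs (pairs `{a i, a (i+1)}` for odd `i < n`)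
are pairwise noncrossing, whose lower arcs (pairs `{a i, a (i+1)}` for even
`1 ≤ i < n`) are pairwise noncrossing, such that no lower arc strictly encloses
`a 1`, and no lower arc (if `n` is even) resp. upper arc (if `n` is odd)
strictly encloses `a n`. -/
def IsOpenMeandricPerm (n : ℕ) (a : ℕ → ℕ) : Prop :=
  1 ≤ n ∧
  (∀ i, 1 ≤ i → i ≤ n → 1 ≤ a i ∧ a i ≤ n) ∧
  (∀ i j, 1 ≤ i → i ≤ n → 1 ≤ j → j ≤ n → a i = a j → i = j) ∧
  (∀ i, 1 ≤ i → i ≤ n → a i % 2 = i % 2) ∧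
  (∀ i j, Odd i → i < n → Odd j → j < n →
      ¬ ArcsCross (a i) (a (i + 1)) (a j) (a (j + 1))) ∧
  (∀ i j, Even i → 1 ≤ i → i < n → Even j → 1 ≤ j → j < n →
      ¬ ArcsCross (a i) (a (i + 1)) (a j) (a (j + 1))) ∧
  (∀ i, Even i → 1 ≤ i → i < n → ¬ StrictlyBetween (a i) (a (i + 1)) (a 1)) ∧
  (if Even n
    then ∀ i, Even i → 1 ≤ i → i < n → ¬ StrictlyBetween (a i) (a (i + 1)) (a n)
    else ∀ i, Odd i → i < n → ¬ StrictlyBetween (a i) (a (i + 1)) (a n))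

/-- An open meandric permutation of order `n` is irreducible if there are no
indices `1 ≤ k₁ < k₂ ≤ n` with `2 < k₂ - k₁ ≤ n - 2` such that the values
`a k₁, …, a k₂` form an interval of integers, i.e. their max minus their min
equals `k₂ - k₁`. -/
def IsIrreducibleMeander (n : ℕ) (a : ℕ → ℕ) : Prop :=
  ¬ ∃ k₁ k₂ : ℕ, ∃ h : k₁ < k₂, 1 ≤ k₁ ∧ k₂ ≤ n ∧ 2 < k₂ - k₁ ∧ k₂ - k₁ ≤ n - 2 ∧
    (Finset.Icc k₁ k₂).sup' (Finset.nonempty_Icc.mpr h.le) a -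
      (Finset.Icc k₁ k₂).inf' (Finset.nonempty_Icc.mpr h.le) a = k₂ - k₁

/-- An open meandric permutation of order `n` is prime if `a 1 ≠ 1` and no proper
initial segment `a 1, …, a j` (`2 ≤ j < n`) is a permutation of `{1, …, j}`. -/
def IsPrimeMeander (n : ℕ) (a : ℕ → ℕ) : Prop :=
  a 1 ≠ 1 ∧ ¬ ∃ j, 2 ≤ j ∧ j < n ∧ (Finset.Icc 1 j).image a = Finset.Icc 1 j

/-- `a` (with one-based indexing) is a closed meandric permutation of order `n`:
a permutation of `{1, …, 2n}` with `a 1 = 1`, `a i ≡ i (mod 2)`, pairwise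
noncrossing upper arcs `{a i, a (i+1)}` (odd `i < 2n`) and pairwise noncrossing
lower arcs, the latter being the `{a i, a (i+1)}` for even `1 ≤ i < 2n` together
with the wrap-around arc `{a (2n), a 1}`. -/
def IsClosedMeandricPerm (n : ℕ) (a : ℕ → ℕ) : Prop :=
  1 ≤ n ∧ a 1 = 1 ∧
  (∀ i, 1 ≤ i → i ≤ 2 * n → 1 ≤ a i ∧ a i ≤ 2 * n) ∧
  (∀ i j, 1 ≤ i → i ≤ 2 * n → 1 ≤ j → j ≤ 2 * n → a i = a j → i = j) ∧
  (∀ i, 1 ≤ i → i ≤ 2 * n → a i % 2 = i % 2) ∧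
  (∀ i j, Odd i → i < 2 * n → Odd j → j < 2 * n →
      ¬ ArcsCross (a i) (a (i + 1)) (a j) (a (j + 1))) ∧
  (∀ i j, Even i → 1 ≤ i → i < 2 * n → Even j → 1 ≤ j → j < 2 * n →
      ¬ ArcsCross (a i) (a (i + 1)) (a j) (a (j + 1))) ∧
  (∀ i, Even i → 1 ≤ i → i < 2 * n →
      ¬ ArcsCross (a i) (a (i + 1)) (a (2 * n)) (a 1) ∧
      ¬ ArcsCross (a (2 * n)) (a 1) (a i) (a (i + 1)))

/-- `M n`: the number of open meandric permutations of order `n` (each counted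
once via the normalization `a i = 0` outside `{1, …, n}`). -/
noncomputable def openMeanderCount (n : ℕ) : ℕ :=
  Set.ncard {a : ℕ → ℕ | IsOpenMeandricPerm n a ∧ ∀ i, i < 1 ∨ n < i → a i = 0}

/-- `M^{Irr} n`: the number of irreducible open meandric permutations of order `n`. -/
noncomputable def irrMeanderCount (n : ℕ) : ℕ :=
  Set.ncard {a : ℕ → ℕ | IsOpenMeandricPerm n a ∧ IsIrreducibleMeander n a ∧
    ∀ i, i < 1 ∨ n < i → a i = 0}

/-- `M^{(P)} n`: the number of prime open meandric permutations of order `n`. -/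
noncomputable def primeMeanderCount (n : ℕ) : ℕ :=
  Set.ncard {a : ℕ → ℕ | IsOpenMeandricPerm n a ∧ IsPrimeMeander n a ∧
    ∀ i, i < 1 ∨ n < i → a i = 0}

/-- `M̄ n`: the number of closed meandric permutations of order `n`. -/
noncomputable def closedMeanderCount (n : ℕ) : ℕ :=
  Set.ncard {a : ℕ → ℕ | IsClosedMeandricPerm n a ∧ ∀ i, i < 1 ∨ 2 * n < i → a i = 0}

/-- The first fifteen entries of the expanded sequence. -/
def headEntries : List ℕ := [23, 22, 1, 4, 19, 26, 27, 18, 5, 8, 15, 32, 33, 14, 11]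

/-- The fifteen entries of the expanded sequence that follow its second block. -/
def tailEntries : List ℕ := [12, 13, 34, 31, 16, 7, 6, 17, 28, 25, 20, 3, 2, 21, 24]

/-- `b` traverses a doubled copy of `a`, forwards and then backwards, between fixed entries. -/
structure IsDoubling (n : ℕ) (a b : ℕ → ℕ) : Prop where
  pre : ∀ i t, i = 1 + t → t < 15 → b i = headEntries.getD t 0
  forth_odd : ∀ i j, i = 15 + j → 1 ≤ j → j ≤ n → j % 2 = 1 → b i = 34 + 2 * a j
  forth_even : ∀ i j, i = 15 + j → 1 ≤ j → j ≤ n → j % 2 = 0 → b i = 33 + 2 * a j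
  turn : b (16 + n) = 29
  turn_succ : b (17 + n) = 30
  back_odd : ∀ i j, i + j = 18 + 2 * n → 1 ≤ j → j ≤ n → j % 2 = 1 → b i = 33 + 2 * a j
  back_even : ∀ i j, i + j = 18 + 2 * n → 1 ≤ j → j ≤ n → j % 2 = 0 → b i = 34 + 2 * a j
  suf : ∀ i t, i = 18 + 2 * n + t → t < 15 → b i = tailEntries.getD t 0
  top : b (33 + 2 * n) = 2 * n + 35
  penultimate : b (34 + 2 * n) = 10
  last : b (35 + 2 * n) = 9

/-- The entries of a doubling that do not depend on `a` or `n`. -/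
def fixedEntries : List ℕ := headEntries ++ [29, 30] ++ tailEntries ++ [10, 9]

/-- The position in a doubling of the fixed entry with index `t`. -/
def fixedPos (n t : ℕ) : ℕ :=
  if t < 15 then t + 1 else if t < 17 then t + n + 1
  else if t < 32 then t + 2 * n + 1 else t + 2 * n + 2

theorem fixedEntries_injective : ∀ s < 34, ∀ t < 34,
    fixedEntries.getD s 0 = fixedEntries.getD t 0 → s = t := by
  decide +kernel

theorem fixedEntries_mem : ∀ t < 34,
    1 ≤ fixedEntries.getD t 0 ∧ fixedEntries.getD t 0 ≤ 34 ∧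
    (t < 15 → fixedEntries.getD t 0 % 2 = (t + 1) % 2) ∧
    (15 ≤ t → t < 17 → fixedEntries.getD t 0 % 2 = t % 2) ∧
    (17 ≤ t → t < 32 → fixedEntries.getD t 0 % 2 = (t + 1) % 2) ∧
    (32 ≤ t → fixedEntries.getD t 0 % 2 = t % 2) := by
  decide +kernel

theorem headEntries_spread : ∀ s < 15, ∀ t < 15, s + 2 < t → ∃ u ≤ t, ∃ v ≤ t, s ≤ u ∧ s ≤ v ∧
    headEntries.getD v 0 + (t - s) < headEntries.getD u 0 := by
  decide +kernel

theorem tailEntries_spread : ∀ s < 15, ∀ t < 15, s + 2 < t → ∃ u ≤ t, ∃ v ≤ t, s ≤ u ∧ s ≤ v ∧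
    tailEntries.getD v 0 + (t - s) < tailEntries.getD u 0 := by
  decide +kernel

/-- The upper arcs between fixed entries. -/
def upperArcs : List (ℕ × ℕ) :=
  [(23, 22), (1, 4), (19, 26), (27, 18), (5, 8), (15, 32), (33, 14), (29, 30),
    (13, 34), (31, 16), (7, 6), (17, 28), (25, 20), (3, 2), (21, 24)]

/-- The lower arcs between fixed entries. -/
def lowerArcs : List (ℕ × ℕ) :=
  [(22, 1), (4, 19), (26, 27), (18, 5), (8, 15), (32, 33), (14, 11),
    (12, 13), (34, 31), (16, 7), (6, 17), (28, 25), (20, 3), (2, 21), (10, 9)]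

theorem arcsCross_iff {p q r s : ℕ} : ArcsCross p q r s ↔
    (min p q < r ∧ r < max p q) ∧ ¬ (min p q < s ∧ s < max p q) ∨
      (min p q < s ∧ s < max p q) ∧ ¬ (min p q < r ∧ r < max p q) :=
  Iff.rfl

instance (p q r s : ℕ) : Decidable (ArcsCross p q r s) :=
  decidable_of_iff' _ arcsCross_iff

theorem upperArcs_noncrossing : ∀ A ∈ upperArcs, ∀ B ∈ upperArcs,
    ¬ ArcsCross A.1 A.2 B.1 B.2 := by
  decide +kernel

theorem lowerArcs_noncrossing : ∀ A ∈ lowerArcs, ∀ B ∈ lowerArcs,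
    ¬ ArcsCross A.1 A.2 B.1 B.2 := by
  decide +kernel

theorem upperArcs_separated : ∀ A ∈ upperArcs, A.1 ≤ 34 ∧ A.2 ≤ 34 ∧
    (A.1 ≤ 8 ∧ A.2 ≤ 8 ∨ 13 ≤ A.1 ∧ 13 ≤ A.2) := by
  decide +kernel

theorem lowerArcs_separated : ∀ A ∈ lowerArcs, A.1 ≤ 34 ∧ A.2 ≤ 34 ∧
    (A.1 ≤ 22 ∧ A.2 ≤ 22 ∨ 25 ≤ A.1 ∧ A.1 ≤ 28 ∧ 25 ≤ A.2 ∧ A.2 ≤ 28 ∨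
      31 ≤ A.1 ∧ 31 ≤ A.2) := by
  decide +kernel

/-- `{p, q}` is one of the two parallel copies of the arc `{x, y}`. -/
def IsCopy (x y p q : ℕ) : Prop :=
  p = 33 + 2 * x ∧ q = 34 + 2 * y ∨ p = 34 + 2 * x ∧ q = 33 + 2 * y ∨
    p = 33 + 2 * y ∧ q = 34 + 2 * x ∨ p = 34 + 2 * y ∧ q = 33 + 2 * x

theorem not_arcsCross_iff {p q r s : ℕ}
    (hpr : p ≠ r) (hps : p ≠ s) (hqr : q ≠ r) (hqs : q ≠ s) :
    ¬ ArcsCross p q r s ↔ ((p < r ↔ q < r) ↔ (p < s ↔ q < s)) := by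
  rw [arcsCross_iff]
  omega

theorem not_arcsCross_of_isCopy {x y z w p q r s : ℕ}
    (h : x = z ∧ y = w ∨
      x ≠ z ∧ x ≠ w ∧ y ≠ z ∧ y ≠ w ∧ ¬ ArcsCross x y z w)
    (hp : IsCopy x y p q) (hr : IsCopy z w r s) : ¬ ArcsCross p q r s := by
  rcases h with ⟨rfl, rfl⟩ | ⟨h1, h2, h3, h4, h⟩
  · rw [arcsCross_iff]
    unfold IsCopy at hp hr
    omega
  · rw [not_arcsCross_iff h1 h2 h3 h4] at h
    unfold IsCopy at hp hr
    rw [not_arcsCross_iff] <;> omega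

/-- The shape of the upper arcs of a doubling. -/
def UpperShape (n : ℕ) (a : ℕ → ℕ) (p q : ℕ) : Prop :=
  (p, q) ∈ upperArcs ∨ (p = 11 ∧ q = 34 + 2 * a 1) ∨ (p = 33 + 2 * a 1 ∧ q = 12) ∨
    (p = 2 * n + 35 ∧ q = 10) ∨
    ∃ k, 1 ≤ k ∧ k < n ∧ Even k ∧ IsCopy (a k) (a (k + 1)) p q

/-- The shape of the lower arcs of a doubling. -/
def LowerShape (n : ℕ) (a : ℕ → ℕ) (p q : ℕ) : Prop :=
  (p, q) ∈ lowerArcs ∨ (p = 34 + 2 * a n ∧ q = 29) ∨ (p = 30 ∧ q = 33 + 2 * a n) ∨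
    (p = 24 ∧ q = 2 * n + 35) ∨
    ∃ k, 1 ≤ k ∧ k < n ∧ Odd k ∧ IsCopy (a k) (a (k + 1)) p q

namespace IsDoubling

variable {n : ℕ} {a b : ℕ → ℕ}

theorem apply_fixedPos (h : IsDoubling n a b) {t : ℕ} (ht : t < 34) :
    b (fixedPos n t) = fixedEntries.getD t 0 := by
  rcases lt_or_ge t 15 with h1 | h1
  · rw [h.pre (fixedPos n t) t (by rw [fixedPos, if_pos h1, add_comm]) h1]
    interval_cases t <;> rfl
  rcases lt_or_ge t 17 with h2 | h2
  · obtain rfl | rfl : t = 15 ∨ t = 16 := by omega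
    · have : fixedPos n 15 = 16 + n := by unfold fixedPos; split_ifs <;> omega
      rw [this, h.turn]; rfl
    · have : fixedPos n 16 = 17 + n := by unfold fixedPos; split_ifs <;> omega
      rw [this, h.turn_succ]; rfl
  rcases lt_or_ge t 32 with h3 | h3
  · rw [h.suf (fixedPos n t) (t - 17) (by unfold fixedPos; split_ifs <;> omega) (by omega)]
    interval_cases t <;> rfl
  · obtain rfl | rfl : t = 32 ∨ t = 33 := by omega
    · have : fixedPos n 32 = 34 + 2 * n := by unfold fixedPos; split_ifs <;> omega
      rw [this, h.penultimate]; rfl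
    · have : fixedPos n 33 = 35 + 2 * n := by unfold fixedPos; split_ifs <;> omega
      rw [this, h.last]; rfl

theorem exists_position {i : ℕ} (h1 : 1 ≤ i) (hi : i ≤ 2 * n + 35) :
    (∃ t < 34, i = fixedPos n t) ∨ i = 33 + 2 * n ∨ (∃ j, 1 ≤ j ∧ j ≤ n ∧ i = 15 + j) ∨
      ∃ j, 1 ≤ j ∧ j ≤ n ∧ i + j = 18 + 2 * n := by
  by_cases hA : i ≤ 15
  · exact .inl ⟨i - 1, by omega, by unfold fixedPos; split_ifs <;> omega⟩
  by_cases hB : i ≤ 15 + n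
  · exact .inr (.inr (.inl ⟨i - 15, by omega, by omega, by omega⟩))
  by_cases hT : i ≤ 17 + n
  · exact .inl ⟨i - n - 1, by omega, by unfold fixedPos; split_ifs <;> omega⟩
  by_cases hC : i ≤ 17 + 2 * n
  · exact .inr (.inr (.inr ⟨18 + 2 * n - i, by omega, by omega, by omega⟩))
  by_cases hD : i ≤ 32 + 2 * n
  · exact .inl ⟨i - 2 * n - 1, by omega, by unfold fixedPos; split_ifs <;> omega⟩
  by_cases hE : i = 33 + 2 * n
  · exact .inr (.inl hE)
  · exact .inl ⟨i - 2 * n - 2, by omega, by unfold fixedPos; split_ifs <;> omega⟩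

theorem forth (h : IsDoubling n a b) {i j : ℕ} (hi : i = 15 + j) (h1 : 1 ≤ j) (hj : j ≤ n) :
    j % 2 = 1 ∧ b i = 34 + 2 * a j ∨ j % 2 = 0 ∧ b i = 33 + 2 * a j := by
  rcases Nat.mod_two_eq_zero_or_one j with e | e
  · exact .inr ⟨e, h.forth_even i j hi h1 hj e⟩
  · exact .inl ⟨e, h.forth_odd i j hi h1 hj e⟩

theorem back (h : IsDoubling n a b) {i j : ℕ} (hi : i + j = 18 + 2 * n) (h1 : 1 ≤ j)
    (hj : j ≤ n) :
    j % 2 = 1 ∧ b i = 33 + 2 * a j ∨ j % 2 = 0 ∧ b i = 34 + 2 * a j := by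
  rcases Nat.mod_two_eq_zero_or_one j with e | e
  · exact .inr ⟨e, h.back_even i j hi h1 hj e⟩
  · exact .inl ⟨e, h.back_odd i j hi h1 hj e⟩

/-- An entry is fixed, the top one, or belongs to one of the two blocks. -/
theorem apply_cases (h : IsDoubling n a b) {i : ℕ} (h1 : 1 ≤ i) (hi : i ≤ 2 * n + 35) :
    (∃ t < 34, i = fixedPos n t ∧ b i = fixedEntries.getD t 0) ∨
    (i = 33 + 2 * n ∧ b i = 2 * n + 35) ∨
    (∃ j, 1 ≤ j ∧ j ≤ n ∧ i = 15 + j ∧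
      (j % 2 = 1 ∧ b i = 34 + 2 * a j ∨ j % 2 = 0 ∧ b i = 33 + 2 * a j)) ∨
    ∃ j, 1 ≤ j ∧ j ≤ n ∧ i + j = 18 + 2 * n ∧
      (j % 2 = 1 ∧ b i = 33 + 2 * a j ∨ j % 2 = 0 ∧ b i = 34 + 2 * a j) := by
  rcases exists_position h1 hi with ⟨t, ht, rfl⟩ | rfl | ⟨j, hj1, hj, e⟩ | ⟨j, hj1, hj, e⟩
  · exact .inl ⟨t, ht, rfl, h.apply_fixedPos ht⟩
  · exact .inr (.inl ⟨rfl, h.top⟩)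
  · exact .inr (.inr (.inl ⟨j, hj1, hj, e, h.forth e hj1 hj⟩))
  · exact .inr (.inr (.inr ⟨j, hj1, hj, e, h.back e hj1 hj⟩))

theorem mem_range (h : IsDoubling n a b) (ha : ∀ i, 1 ≤ i → i ≤ n → 1 ≤ a i ∧ a i ≤ n)
    (i : ℕ) (h1 : 1 ≤ i) (hi : i ≤ 2 * n + 35) : 1 ≤ b i ∧ b i ≤ 2 * n + 35 := by
  rcases h.apply_cases h1 hi with ⟨t, ht, -, e⟩ | ⟨-, e⟩ | ⟨j, hj1, hj, -, e⟩ | ⟨j, hj1, hj, -, e⟩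
  · have := fixedEntries_mem t ht
    omega
  · omega
  · have := ha j hj1 hj
    omega
  · have := ha j hj1 hj
    omega

theorem injective (h : IsDoubling n a b) (ha : ∀ i, 1 ≤ i → i ≤ n → 1 ≤ a i ∧ a i ≤ n)
    (hinj : ∀ i j, 1 ≤ i → i ≤ n → 1 ≤ j → j ≤ n → a i = a j → i = j)
    (i j : ℕ) (hi1 : 1 ≤ i) (hi : i ≤ 2 * n + 35) (hj1 : 1 ≤ j) (hj : j ≤ 2 * n + 35)
    (hij : b i = b j) : i = j := by
  rcases h.apply_cases hi1 hi with
      ⟨t, ht, p, e⟩ | ⟨p, e⟩ | ⟨k, hk1, hk, p, e⟩ | ⟨k, hk1, hk, p, e⟩ <;>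
    rcases h.apply_cases hj1 hj with
      ⟨t', ht', p', e'⟩ | ⟨p', e'⟩ | ⟨k', hk1', hk', p', e'⟩ | ⟨k', hk1', hk', p', e'⟩ <;>
    first
      | (have := fixedEntries_injective t ht t' ht' (by omega)
         subst this
         omega)
      | (have := hinj k k' hk1 hk hk1' hk'
         omega)
      | (try have := ha k hk1 hk
         try have := ha k' hk1' hk'
         try have := fixedEntries_mem t ht
         try have := fixedEntries_mem t' ht'
         omega)

theorem mod_two (h : IsDoubling n a b) (hn : n % 2 = 1)
    (i : ℕ) (h1 : 1 ≤ i) (hi : i ≤ 2 * n + 35) : b i % 2 = i % 2 := by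
  rcases h.apply_cases h1 hi with ⟨t, ht, p, e⟩ | ⟨p, e⟩ | ⟨j, hj1, hj, p, e⟩ | ⟨j, hj1, hj, p, e⟩
  · have := fixedEntries_mem t ht
    unfold fixedPos at p
    split_ifs at p <;> omega
  all_goals omega

theorem upperShape (h : IsDoubling n a b) (hn : n % 2 = 1) {i : ℕ} (hi : i % 2 = 1)
    (hin : i < 2 * n + 35) : UpperShape n a (b i) (b (i + 1)) := by
  by_cases hA : i < 15
  · left
    rw [h.pre i (i - 1) (by omega) (by omega), h.pre (i + 1) i (by omega) hA]
    interval_cases i <;> first | omega | decide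
  by_cases hA' : i = 15
  · right; left
    exact ⟨h.pre i 14 (by omega) (by omega),
      h.forth_odd (i + 1) 1 (by omega) (by omega) (by omega) rfl⟩
  by_cases hB : i < 16 + n
  · refine .inr (.inr (.inr (.inr ⟨i - 15, by omega, by omega, by grind, ?_⟩)))
    have e1 := h.forth_even i (i - 15) (by omega) (by omega) (by omega) (by omega)
    have e2 := h.forth_odd (i + 1) (i - 15 + 1) (by omega) (by omega) (by omega) (by omega)
    exact .inl ⟨e1, e2⟩
  by_cases hT : i = 16 + n
  · left
    rw [show i + 1 = 17 + n by omega, hT, h.turn, h.turn_succ]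
    decide
  by_cases hC : i < 17 + 2 * n
  · refine .inr (.inr (.inr (.inr ⟨17 + 2 * n - i, by omega, by omega, by grind, ?_⟩)))
    have e1 := h.back_odd i (17 + 2 * n - i + 1) (by omega) (by omega) (by omega) (by omega)
    have e2 := h.back_even (i + 1) (17 + 2 * n - i) (by omega) (by omega) (by omega) (by omega)
    exact .inr (.inr (.inl ⟨e1, e2⟩))
  by_cases hC' : i = 17 + 2 * n
  · exact .inr (.inr (.inl ⟨h.back_odd i 1 (by omega) (by omega) (by omega) rfl,
      h.suf (i + 1) 0 (by omega) (by omega)⟩))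
  by_cases hD : i < 32 + 2 * n
  · left
    obtain ⟨t, rfl⟩ : ∃ t, i = 18 + 2 * n + t := ⟨i - (18 + 2 * n), by omega⟩
    have ht : t < 14 := by omega
    rw [h.suf _ t rfl (by omega), h.suf _ (t + 1) (by omega) (by omega)]
    interval_cases t <;> first | omega | decide
  · have hE : i = 33 + 2 * n := by omega
    subst hE
    have := h.penultimate
    exact .inr (.inr (.inr (.inl ⟨h.top, by rwa [show 33 + 2 * n + 1 = 34 + 2 * n by omega]⟩)))

theorem lowerShape (h : IsDoubling n a b) (hn : n % 2 = 1) {i : ℕ} (hi : i % 2 = 0)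
    (hi1 : 1 ≤ i) (hin : i < 2 * n + 35) : LowerShape n a (b i) (b (i + 1)) := by
  by_cases hA : i < 15
  · left
    rw [h.pre i (i - 1) (by omega) (by omega), h.pre (i + 1) i (by omega) hA]
    interval_cases i <;> first | omega | decide
  by_cases hB : i < 15 + n
  · refine .inr (.inr (.inr (.inr ⟨i - 15, by omega, by omega, by grind, ?_⟩)))
    have e1 := h.forth_odd i (i - 15) (by omega) (by omega) (by omega) (by omega)
    have e2 := h.forth_even (i + 1) (i - 15 + 1) (by omega) (by omega) (by omega) (by omega)
    exact .inr (.inl ⟨e1, e2⟩)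
  by_cases hB' : i = 15 + n
  · subst hB'
    exact .inr (.inl ⟨h.forth_odd _ n rfl (by omega) le_rfl hn, by
      rw [show 15 + n + 1 = 16 + n by omega, h.turn]⟩)
  by_cases hT : i = 17 + n
  · subst hT
    exact .inr (.inr (.inl ⟨h.turn_succ, h.back_odd _ n (by omega) (by omega) le_rfl hn⟩))
  by_cases hC : i < 17 + 2 * n
  · refine .inr (.inr (.inr (.inr ⟨17 + 2 * n - i, by omega, by omega, by grind, ?_⟩)))
    have e1 := h.back_even i (17 + 2 * n - i + 1) (by omega) (by omega) (by omega) (by omega)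
    have e2 := h.back_odd (i + 1) (17 + 2 * n - i) (by omega) (by omega) (by omega) (by omega)
    exact .inr (.inr (.inr ⟨e1, e2⟩))
  by_cases hD : i < 32 + 2 * n
  · left
    obtain ⟨t, rfl⟩ : ∃ t, i = 18 + 2 * n + t := ⟨i - (18 + 2 * n), by omega⟩
    have ht : t < 14 := by omega
    rw [h.suf _ t rfl (by omega), h.suf _ (t + 1) (by omega) (by omega)]
    interval_cases t <;> first | omega | decide
  by_cases hD' : i = 32 + 2 * n
  · subst hD'
    exact .inr (.inr (.inr (.inl ⟨h.suf _ 14 (by omega) (by omega), by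
      rw [show 32 + 2 * n + 1 = 33 + 2 * n by omega, h.top]⟩)))
  · left
    obtain rfl : i = 34 + 2 * n := by omega
    rw [show 34 + 2 * n + 1 = 35 + 2 * n by omega, h.penultimate, h.last]
    decide

end IsDoubling

/-- Copies of two arcs joining consecutive entries, at indices of the same parity, do not cross
when the arcs themselves do not cross. -/
theorem not_arcsCross_of_isCopy_consecutive {n k l p q r s : ℕ} {a : ℕ → ℕ}
    (hinj : ∀ i j, 1 ≤ i → i ≤ n → 1 ≤ j → j ≤ n → a i = a j → i = j)
    (hk1 : 1 ≤ k) (hk : k < n) (hl1 : 1 ≤ l) (hl : l < n) (hkl : k % 2 = l % 2)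
    (hc : ¬ ArcsCross (a k) (a (k + 1)) (a l) (a (l + 1)))
    (hp : IsCopy (a k) (a (k + 1)) p q) (hr : IsCopy (a l) (a (l + 1)) r s) :
    ¬ ArcsCross p q r s := by
  have ne : ∀ {i j}, 1 ≤ i → i ≤ n → 1 ≤ j → j ≤ n → i ≠ j → a i ≠ a j :=
    fun h1 h2 h3 h4 h5 h6 => h5 (hinj _ _ h1 h2 h3 h4 h6)
  refine not_arcsCross_of_isCopy ?_ hp hr
  by_cases e : k = l
  · subst e
    exact .inl ⟨rfl, rfl⟩
  · exact .inr ⟨ne (by omega) (by omega) (by omega) (by omega) (by omega),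
      ne (by omega) (by omega) (by omega) (by omega) (by omega),
      ne (by omega) (by omega) (by omega) (by omega) (by omega),
      ne (by omega) (by omega) (by omega) (by omega) (by omega), hc⟩

/-- A copy of an arc that does not enclose `z` has both ends on the same side of both copies
of `z`, and lies in the range of the doubled values. -/
theorem IsCopy.same_side {n x y z p q : ℕ} (hc : IsCopy x y p q) (hx : 1 ≤ x ∧ x ≤ n)
    (hy : 1 ≤ y ∧ y ≤ n) (hxz : x ≠ z) (hyz : y ≠ z) (hz : ¬ StrictlyBetween x y z) :
    35 ≤ p ∧ 35 ≤ q ∧ p < 2 * n + 35 ∧ q < 2 * n + 35 ∧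
      (p < 33 + 2 * z ∧ q < 33 + 2 * z ∨ 34 + 2 * z < p ∧ 34 + 2 * z < q) := by
  unfold StrictlyBetween at hz
  unfold IsCopy at hc
  omega

theorem UpperShape.noncrossing {n : ℕ} {a : ℕ → ℕ} (ha : IsOpenMeandricPerm n a) {p q r s : ℕ}
    (h : UpperShape n a p q) (h' : UpperShape n a r s) : ¬ ArcsCross p q r s := by
  obtain ⟨hn, hmem, hinj, -, -, hlow, hone, -⟩ := ha
  have side : ∀ {k p q}, 1 ≤ k → k < n → Even k → IsCopy (a k) (a (k + 1)) p q →
      35 ≤ p ∧ 35 ≤ q ∧ p < 2 * n + 35 ∧ q < 2 * n + 35 ∧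
      (p < 33 + 2 * a 1 ∧ q < 33 + 2 * a 1 ∨ 34 + 2 * a 1 < p ∧ 34 + 2 * a 1 < q) := by
    intro k p q hk1 hk hke hc
    have hk2 : k % 2 = 0 := Nat.even_iff.mp hke
    refine hc.same_side (hmem _ hk1 hk.le) (hmem _ (by omega) hk) (fun e => ?_) (fun e => ?_)
      (hone k hke hk1 hk)
    · have := hinj _ _ hk1 hk.le le_rfl hn e
      omega
    · have := hinj _ _ (by omega) hk le_rfl hn e
      omega
  have h1 := hmem 1 le_rfl hn
  rcases h with h | h | h | h | ⟨k, hk1, hk, hke, hc⟩ <;>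
    rcases h' with h' | h' | h' | h' | ⟨l, hl1, hl, hle, hc'⟩ <;>
    first
      | exact upperArcs_noncrossing _ h _ h'
      | exact not_arcsCross_of_isCopy_consecutive hinj hk1 hk hl1 hl
          (by rw [Nat.even_iff.mp hke, Nat.even_iff.mp hle])
          (hlow k l hke hk1 hk hle hl1 hl) hc hc'
      | (try have hs := upperArcs_separated _ h
         try have hs' := upperArcs_separated _ h'
         try have hs := side hk1 hk hke hc
         try have hs' := side hl1 hl hle hc'
         rw [arcsCross_iff]
         omega)

theorem LowerShape.noncrossing {n : ℕ} {a : ℕ → ℕ} (ha : IsOpenMeandricPerm n a)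
    (hodd : Odd n) {p q r s : ℕ}
    (h : LowerShape n a p q) (h' : LowerShape n a r s) : ¬ ArcsCross p q r s := by
  obtain ⟨hn, hmem, hinj, -, hup, -, -, hlast⟩ := ha
  rw [if_neg (Nat.not_even_iff_odd.mpr hodd)] at hlast
  have side : ∀ {k p q}, 1 ≤ k → k < n → Odd k → IsCopy (a k) (a (k + 1)) p q →
      35 ≤ p ∧ 35 ≤ q ∧ p < 2 * n + 35 ∧ q < 2 * n + 35 ∧
      (p < 33 + 2 * a n ∧ q < 33 + 2 * a n ∨ 34 + 2 * a n < p ∧ 34 + 2 * a n < q) := by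
    intro k p q hk1 hk hke hc
    have hk2 : k % 2 = 1 := Nat.odd_iff.mp hke
    have hn2 : n % 2 = 1 := Nat.odd_iff.mp hodd
    refine hc.same_side (hmem _ hk1 hk.le) (hmem _ (by omega) hk) (fun e => ?_) (fun e => ?_)
      (hlast k hke hk)
    · have := hinj _ _ hk1 hk.le hn le_rfl e
      omega
    · have := hinj _ _ (by omega) hk hn le_rfl e
      omega
  have h1 := hmem n hn le_rfl
  rcases h with h | h | h | h | ⟨k, hk1, hk, hke, hc⟩ <;>
    rcases h' with h' | h' | h' | h' | ⟨l, hl1, hl, hle, hc'⟩ <;>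
    first
      | exact lowerArcs_noncrossing _ h _ h'
      | exact not_arcsCross_of_isCopy_consecutive hinj hk1 hk hl1 hl
          (by rw [Nat.odd_iff.mp hke, Nat.odd_iff.mp hle])
          (hup k l hke hk hle hl) hc hc'
      | (try have hs := lowerArcs_separated _ h
         try have hs' := lowerArcs_separated _ h'
         try have hs := side hk1 hk hke hc
         try have hs' := side hl1 hl hle hc'
         rw [arcsCross_iff]
         omega)

theorem UpperShape.not_strictlyBetween {n : ℕ} {a : ℕ → ℕ} {p q : ℕ}
    (h : UpperShape n a p q) : ¬ StrictlyBetween p q 9 := by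
  unfold StrictlyBetween
  rcases h with h | h | h | h | ⟨k, -, -, -, hc⟩
  · have := upperArcs_separated _ h
    omega
  iterate 3 omega
  · unfold IsCopy at hc
    omega

theorem LowerShape.not_strictlyBetween {n : ℕ} {a : ℕ → ℕ} {p q : ℕ}
    (h : LowerShape n a p q) : ¬ StrictlyBetween p q 23 := by
  unfold StrictlyBetween
  rcases h with h | h | h | h | ⟨k, -, -, -, hc⟩
  · have := lowerArcs_separated _ h
    omega
  iterate 3 omega
  · unfold IsCopy at hc
    omega

theorem IsDoubling.isOpenMeandricPerm {n : ℕ} {a b : ℕ → ℕ} (h : IsDoubling n a b)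
    (hodd : Odd n) (ha : IsOpenMeandricPerm n a) : IsOpenMeandricPerm (2 * n + 35) b := by
  have hn : n % 2 = 1 := Nat.odd_iff.mp hodd
  have hmem := ha.2.1
  refine ⟨by omega, h.mem_range hmem, h.injective hmem ha.2.2.1, h.mod_two hn, ?_, ?_, ?_, ?_⟩
  · intro i j hi hin hj hjn
    exact (h.upperShape hn (Nat.odd_iff.mp hi) hin).noncrossing ha
      (h.upperShape hn (Nat.odd_iff.mp hj) hjn)
  · intro i j hi hi1 hin hj hj1 hjn
    exact (h.lowerShape hn (Nat.even_iff.mp hi) hi1 hin).noncrossing ha hodd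
      (h.lowerShape hn (Nat.even_iff.mp hj) hj1 hjn)
  · intro i hi hi1 hin
    have e : b 1 = 23 := h.pre 1 0 rfl (by omega)
    rw [e]
    exact (h.lowerShape hn (Nat.even_iff.mp hi) hi1 hin).not_strictlyBetween
  · rw [if_neg (by grind)]
    intro i hi hin
    rw [show 2 * n + 35 = 35 + 2 * n by omega, h.last]
    exact (h.upperShape hn (Nat.odd_iff.mp hi) hin).not_strictlyBetween

/-- If the values of an injective sequence on `[k₁, k₂]` span an interval of length `k₂ - k₁`,
then any two of them differ by at most `k₂ - k₁`, and every index whose value lies between two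
of them belongs to `[k₁, k₂]`. -/
theorem window_of_sup'_sub_inf' {N k₁ k₂ : ℕ} {b : ℕ → ℕ}
    (hinj : ∀ i j, 1 ≤ i → i ≤ N → 1 ≤ j → j ≤ N → b i = b j → i = j)
    (h : k₁ < k₂) (h1 : 1 ≤ k₁) (h2 : k₂ ≤ N)
    (hspan : (Finset.Icc k₁ k₂).sup' (Finset.nonempty_Icc.mpr h.le) b -
      (Finset.Icc k₁ k₂).inf' (Finset.nonempty_Icc.mpr h.le) b = k₂ - k₁) :
    (∀ i j, k₁ ≤ i → i ≤ k₂ → k₁ ≤ j → j ≤ k₂ → b i ≤ b j + (k₂ - k₁)) ∧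
    ∀ i j l, k₁ ≤ i → i ≤ k₂ → k₁ ≤ j → j ≤ k₂ → 1 ≤ l → l ≤ N → b i ≤ b l → b l ≤ b j →
      k₁ ≤ l ∧ l ≤ k₂ := by
  set M := (Finset.Icc k₁ k₂).sup' (Finset.nonempty_Icc.mpr h.le) b
  set m := (Finset.Icc k₁ k₂).inf' (Finset.nonempty_Icc.mpr h.le) b
  have hM : ∀ i, k₁ ≤ i → i ≤ k₂ → b i ≤ M := fun i hi hi' =>
    Finset.le_sup' b (Finset.mem_Icc.mpr ⟨hi, hi'⟩)
  have hm : ∀ i, k₁ ≤ i → i ≤ k₂ → m ≤ b i := fun i hi hi' =>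
    Finset.inf'_le b (Finset.mem_Icc.mpr ⟨hi, hi'⟩)
  refine ⟨fun i j hi hi' hj hj' => ?_, fun i j l hi hi' hj hj' hl hl' hil hlj => ?_⟩
  · have := hM i hi hi'
    have := hm j hj hj'
    omega
  · have himage : (Finset.Icc k₁ k₂).image b = Finset.Icc m M := by
      refine Finset.eq_of_subset_of_card_le ?_ ?_
      · intro x hx
        obtain ⟨y, hy, rfl⟩ := Finset.mem_image.mp hx
        rw [Finset.mem_Icc] at hy ⊢
        exact ⟨hm y hy.1 hy.2, hM y hy.1 hy.2⟩
      · rw [Finset.card_image_of_injOn, Nat.card_Icc, Nat.card_Icc]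
        · omega
        · intro x hx y hy hxy
          have hx := Finset.mem_Icc.mp (Finset.mem_coe.mp hx)
          have hy := Finset.mem_Icc.mp (Finset.mem_coe.mp hy)
          exact hinj x y (by omega) (by omega) (by omega) (by omega) hxy
    have hl_mem : b l ∈ (Finset.Icc k₁ k₂).image b := by
      rw [himage, Finset.mem_Icc]
      exact ⟨(hm i hi hi').trans hil, hlj.trans (hM j hj hj')⟩
    obtain ⟨y, hy, hyl⟩ := Finset.mem_image.mp hl_mem
    rw [Finset.mem_Icc] at hy
    rwa [← hinj y l (by omega) (by omega) hl hl' hyl]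

/-- A window of a doubling with interval image that has a value at most `32` and a value at
least `34` is everything. -/
theorem IsDoubling.window_eq_univ {n : ℕ} {a b : ℕ → ℕ} (h : IsDoubling n a b) {k₁ k₂ i j : ℕ}
    (hconv : ∀ i j l, k₁ ≤ i → i ≤ k₂ → k₁ ≤ j → j ≤ k₂ → 1 ≤ l → l ≤ 2 * n + 35 →
      b i ≤ b l → b l ≤ b j → k₁ ≤ l ∧ l ≤ k₂)
    (hi : k₁ ≤ i) (hi' : i ≤ k₂) (hj : k₁ ≤ j) (hj' : j ≤ k₂) (hbi : b i ≤ 32)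
    (hbj : 34 ≤ b j) : k₁ ≤ 1 ∧ 2 * n + 35 ≤ k₂ := by
  have e1 : b 1 = 23 := h.pre _ 0 rfl (by omega)
  have e5 : b 5 = 19 := h.pre _ 4 rfl (by omega)
  have e10 : b 10 = 8 := h.pre _ 9 rfl (by omega)
  have e12 : b 12 = 32 := h.pre _ 11 rfl (by omega)
  have e13 : b 13 = 33 := h.pre _ 12 rfl (by omega)
  have f12 : b (18 + 2 * n) = 12 := h.suf _ 0 rfl (by omega)
  have f34 : b (20 + 2 * n) = 34 := h.suf _ 2 (by omega) (by omega)
  have f2 : b (30 + 2 * n) = 2 := h.suf _ 12 (by omega) (by omega)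
  have f21 : b (31 + 2 * n) = 21 := h.suf _ 13 (by omega) (by omega)
  have f9 := h.last
  have ftop := h.top
  have w12 := hconv i j 12 hi hi' hj hj' (by omega) (by omega) (by omega) (by omega)
  have w34 := hconv i j (20 + 2 * n) hi hi' hj hj' (by omega) (by omega) (by omega) (by omega)
  have w5 := hconv (18 + 2 * n) 13 5 (by omega) (by omega) (by omega) (by omega) (by omega)
    (by omega) (by omega) (by omega)
  have w21 := hconv (18 + 2 * n) 13 (31 + 2 * n) (by omega) (by omega) (by omega) (by omega)
    (by omega) (by omega) (by omega) (by omega)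
  have w9 := hconv (30 + 2 * n) 12 (35 + 2 * n) (by omega) (by omega) (by omega) (by omega)
    (by omega) (by omega) (by omega) (by omega)
  have w1 := hconv (18 + 2 * n) 13 1 (by omega) (by omega) (by omega) (by omega)
    (by omega) (by omega) (by omega) (by omega)
  omega

/-- A block entry differs by one from the entry at the reflected position. -/
theorem IsDoubling.apply_reflect {n : ℕ} {a b : ℕ → ℕ} (h : IsDoubling n a b) {i i' : ℕ}
    (hi : i + i' = 33 + 2 * n)
    (hmem : 16 ≤ i ∧ i ≤ 15 + n ∨ 18 + n ≤ i ∧ i ≤ 17 + 2 * n) :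
    i % 2 = 0 ∧ b i = b i' + 1 ∨ i % 2 = 1 ∧ b i' = b i + 1 := by
  rcases hmem with hmem | hmem
  · have := h.forth (i := i) (j := i - 15) (by omega) (by omega) (by omega)
    have := h.back (i := i') (j := i - 15) (by omega) (by omega) (by omega)
    omega
  · have := h.forth (i := i') (j := i' - 15) (by omega) (by omega) (by omega)
    have := h.back (i := i) (j := i' - 15) (by omega) (by omega) (by omega)
    omega

theorem IsDoubling.thirty_five_le {n : ℕ} {a b : ℕ → ℕ} (h : IsDoubling n a b)
    (ha : ∀ i, 1 ≤ i → i ≤ n → 1 ≤ a i ∧ a i ≤ n) {i : ℕ}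
    (hi : 16 ≤ i ∧ i ≤ 15 + n ∨ 18 + n ≤ i ∧ i ≤ 17 + 2 * n) : 35 ≤ b i := by
  rcases hi with hi | hi
  · have := h.forth (i := i) (j := i - 15) (by omega) (by omega) (by omega)
    have := ha (i - 15) (by omega) (by omega)
    omega
  · have := h.back (i := i) (j := 18 + 2 * n - i) (by omega) (by omega) (by omega)
    have := ha (18 + 2 * n - i) (by omega) (by omega)
    omega

theorem IsDoubling.isIrreducibleMeander {n : ℕ} {a b : ℕ → ℕ} (h : IsDoubling n a b)
    (hn : 1 ≤ n) (ha : ∀ i, 1 ≤ i → i ≤ n → 1 ≤ a i ∧ a i ≤ n)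
    (hinj : ∀ i j, 1 ≤ i → i ≤ 2 * n + 35 → 1 ≤ j → j ≤ 2 * n + 35 → b i = b j → i = j) :
    IsIrreducibleMeander (2 * n + 35) b := by
  rintro ⟨k₁, k₂, hk, h1, h2, hlt, hle, hspan⟩
  obtain ⟨hdiff, hconv⟩ := window_of_sup'_sub_inf' hinj hk h1 h2 hspan
  clear hspan
  have key : ∀ i j, k₁ ≤ i → i ≤ k₂ → k₁ ≤ j → j ≤ k₂ → b i ≤ 32 → 34 ≤ b j → False := by
    intro i j hi hi' hj hj' hbi hbj
    have := h.window_eq_univ hconv hi hi' hj hj' hbi hbj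
    omega
  have turn := h.turn
  have turn_succ := h.turn_succ
  have big := @IsDoubling.thirty_five_le n a b h ha
  have block : 16 ≤ k₁ ∧ k₂ ≤ 15 + n ∨ 18 + n ≤ k₁ ∧ k₂ ≤ 17 + 2 * n → False := by
    intro hb
    have r1 := h.apply_reflect (i := k₁) (i' := 33 + 2 * n - k₁) (by omega) (by omega)
    have r2 := h.apply_reflect (i := k₁ + 2) (i' := 33 + 2 * n - (k₁ + 2)) (by omega) (by omega)
    have hne : b k₁ ≠ b (k₁ + 2) := fun e => by
      have := hinj _ _ h1 (by omega) (by omega) (by omega) e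
      omega
    rcases Nat.lt_or_gt_of_ne hne with hlt' | hlt'
    · have c1 := hconv k₁ (k₁ + 2) (33 + 2 * n - k₁) (by omega) (by omega) (by omega) (by omega)
        (by omega) (by omega)
      have c2 := hconv k₁ (k₁ + 2) (33 + 2 * n - (k₁ + 2)) (by omega) (by omega) (by omega)
        (by omega) (by omega) (by omega)
      omega
    · have c1 := hconv (k₁ + 2) k₁ (33 + 2 * n - k₁) (by omega) (by omega) (by omega) (by omega)
        (by omega) (by omega)
      have c2 := hconv (k₁ + 2) k₁ (33 + 2 * n - (k₁ + 2)) (by omega) (by omega) (by omega)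
        (by omega) (by omega) (by omega)
      omega
  by_cases hA : k₂ ≤ 15
  · obtain ⟨u, hu, v, hv, hu', hv', huv⟩ :=
      headEntries_spread (k₁ - 1) (by omega) (k₂ - 1) (by omega) (by omega)
    have := hdiff (1 + u) (1 + v) (by omega) (by omega) (by omega) (by omega)
    rw [h.pre _ u rfl (by omega), h.pre _ v rfl (by omega)] at this
    omega
  by_cases hA' : k₁ ≤ 15
  · refine key 15 16 hA' (by omega) (by omega) (by omega) ?_ ?_
    · rw [h.pre _ 14 rfl (by omega)]
      decide
    · have := big (i := 16) (by omega)
      omega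
  by_cases hB : k₂ ≤ 15 + n
  · exact block (by omega)
  by_cases hB' : k₁ ≤ 15 + n
  · have := big (i := 15 + n) (by omega)
    exact key (16 + n) (15 + n) (by omega) (by omega) (by omega) (by omega) (by omega) (by omega)
  by_cases hT : k₁ ≤ 17 + n
  · have := big (i := 18 + n) (by omega)
    exact key (17 + n) (18 + n) (by omega) (by omega) (by omega) (by omega) (by omega) (by omega)
  by_cases hC : k₂ ≤ 17 + 2 * n
  · exact block (by omega)
  by_cases hC' : k₁ ≤ 17 + 2 * n
  · have := big (i := 17 + 2 * n) (by omega)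
    refine key (18 + 2 * n) (17 + 2 * n) (by omega) (by omega) (by omega) (by omega) ?_ (by omega)
    rw [h.suf _ 0 (by omega) (by omega)]
    decide
  by_cases hD : k₂ ≤ 32 + 2 * n
  · obtain ⟨u, hu, v, hv, hu', hv', huv⟩ :=
      tailEntries_spread (k₁ - (18 + 2 * n)) (by omega) (k₂ - (18 + 2 * n)) (by omega) (by omega)
    have := hdiff (18 + 2 * n + u) (18 + 2 * n + v) (by omega) (by omega) (by omega) (by omega)
    rw [h.suf _ u rfl (by omega), h.suf _ v rfl (by omega)] at this
    omega
  · have := h.top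
    refine key (32 + 2 * n) (33 + 2 * n) (by omega) (by omega) (by omega) (by omega) ?_ (by omega)
    rw [h.suf _ 14 (by omega) (by omega)]
    decide

/-- From an open meandric permutation of odd order `n`, the
described sequence of length `2n + 35` is an irreducible open meandric
permutation of order `2n + 35`. -/
theorem irr_construction_odd_35 (n : ℕ) (hn : Odd n) (a : ℕ → ℕ)
    (ha : IsOpenMeandricPerm n a) (b : ℕ → ℕ)
    (hb : ∀ i, b i =
      if i ≤ 15 then
        [23, 22, 1, 4, 19, 26, 27, 18, 5, 8, 15, 32, 33, 14, 11].getD (i - 1) 0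
      else if i ≤ 15 + n then
        (if Odd (i - 15) then 34 + 2 * a (i - 15) else 34 + 2 * a (i - 15) - 1)
      else if i = 16 + n then 29
      else if i = 17 + n then 30
      else if i ≤ 17 + 2 * n then
        (if Odd (i - (17 + n)) then 34 + 2 * a (n + 1 - (i - (17 + n))) - 1
         else 34 + 2 * a (n + 1 - (i - (17 + n))))
      else if i ≤ 32 + 2 * n then
        [12, 13, 34, 31, 16, 7, 6, 17, 28, 25, 20, 3, 2, 21, 24].getD
          (i - (18 + 2 * n)) 0
      else if i = 33 + 2 * n then 2 * n + 35
      else if i = 34 + 2 * n then 10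
      else if i = 35 + 2 * n then 9
      else 0) :
    IsOpenMeandricPerm (2 * n + 35) b ∧ IsIrreducibleMeander (2 * n + 35) b := by
  have hd : IsDoubling n a b := by
    constructor
    · intro i t hi ht
      rw [hb, if_pos (by omega), hi, Nat.add_sub_cancel_left, headEntries]
    · intro i j hi hj1 hj hodd
      rw [hb, if_neg (by omega), if_pos (by omega), if_pos (by rw [Nat.odd_iff]; omega),
        hi, Nat.add_sub_cancel_left]
    · intro i j hi hj1 hj heven
      rw [hb, if_neg (by omega), if_pos (by omega), if_neg (by rw [Nat.odd_iff]; omega),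
        hi, Nat.add_sub_cancel_left]
      omega
    · rw [hb, if_neg (by omega), if_neg (by omega), if_pos rfl]
    · rw [hb, if_neg (by omega), if_neg (by omega), if_neg (by omega), if_pos rfl]
    · intro i j hi hj1 hj hodd
      have := Nat.odd_iff.mp hn
      rw [hb, if_neg (by omega), if_neg (by omega), if_neg (by omega), if_neg (by omega),
        if_pos (by omega), if_pos (by rw [Nat.odd_iff]; omega),
        show n + 1 - (i - (17 + n)) = j by omega]
      omega
    · intro i j hi hj1 hj heven
      have := Nat.odd_iff.mp hn
      rw [hb, if_neg (by omega), if_neg (by omega), if_neg (by omega), if_neg (by omega),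
        if_pos (by omega), if_neg (by rw [Nat.odd_iff]; omega),
        show n + 1 - (i - (17 + n)) = j by omega]
    · intro i t hi ht
      rw [hb, if_neg (by omega), if_neg (by omega), if_neg (by omega), if_neg (by omega),
        if_neg (by omega), if_pos (by omega), hi, Nat.add_sub_cancel_left, tailEntries]
    · rw [hb, if_neg (by omega), if_neg (by omega), if_neg (by omega), if_neg (by omega),
        if_neg (by omega), if_neg (by omega), if_pos rfl]
    · rw [hb, if_neg (by omega), if_neg (by omega), if_neg (by omega), if_neg (by omega),
        if_neg (by omega), if_neg (by omega), if_neg (by omega), if_pos rfl]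
    · rw [hb, if_neg (by omega), if_neg (by omega), if_neg (by omega), if_neg (by omega),
        if_neg (by omega), if_neg (by omega), if_neg (by omega), if_neg (by omega), if_pos rfl]
  have hperm := hd.isOpenMeandricPerm hn ha
  exact ⟨hperm, hd.isIrreducibleMeander ha.1 ha.2.1 hperm.2.2.1⟩
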